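/- arXiv:math/0403483 — 6 statements merged into one kernel-verified Lean document; each statement's English description precedes it below -/
import Mathlib

section
/- Let X be a nonempty compact topological space and let M, H : X → ℝ be lower semicontinuous functions with H(x) ≥ 0 for all x and such that the set {x ∈ X : H(x) = 0} is nonempty. For ε > 0 define the penalized functional F_ε(x) := M(x) + H(x)/ε. Then the infimum of F_ε over X converges, as ε → 0⁺, to the infimum of M over the zero set of H: lim_{ε→0⁺} inf_{x ∈ X} (M(x) + H(x)/ε) = inf {M(x) : x ∈ X, H(x) = 0}. -/
/-- On a sublevel set of `M` that avoids the zero set of `H`, the penalty `H` is bounded below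
by a positive constant. -/
theorem exists_pos_le_of_sublevel {X : Type*} [TopologicalSpace X] [CompactSpace X]
    {M H : X → ℝ} (hM : LowerSemicontinuous M) (hH : LowerSemicontinuous H) {c : ℝ}
    (hpos : ∀ x, M x ≤ c → 0 < H x) : ∃ δ > 0, ∀ x, M x ≤ c → δ ≤ H x := by
  rcases (M ⁻¹' Set.Iic c).eq_empty_or_nonempty with hK | hK
  · exact ⟨1, one_pos, fun x hx => (Set.eq_empty_iff_forall_notMem.1 hK x hx).elim⟩
  · obtain ⟨a, ha, hmin⟩ := (hH.lowerSemicontinuousOn _).exists_isMinOn hK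
      (hM.isClosed_preimage c).isCompact
    exact ⟨H a, hpos a ha, fun x hx => hmin hx⟩

/-- Convergence of the penalized infima: for lower semicontinuous `M, H` on a
nonempty compact space with `H ≥ 0` and nonempty zero set, the infimum of
`F_ε = M + H/ε` tends, as `ε → 0⁺`, to the infimum of `M` on `{H = 0}`. -/
theorem penalty_infimum_convergence {X : Type*} [TopologicalSpace X] [CompactSpace X]
    [Nonempty X] (M H : X → ℝ) (hM : LowerSemicontinuous M) (hH : LowerSemicontinuous H)
    (hH0 : ∀ x, 0 ≤ H x) (hne : {x | H x = 0}.Nonempty) :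
    Filter.Tendsto (fun ε : ℝ => ⨅ x : X, (M x + H x / ε))
      (nhdsWithin 0 (Set.Ioi 0))
      (nhds (sInf (M '' {x | H x = 0}))) := by
  obtain ⟨b, hb⟩ : BddBelow (Set.range M) := by
    simpa using (hM.lowerSemicontinuousOn Set.univ).bddBelow_of_isCompact isCompact_univ
  have hbM : ∀ x, b ≤ M x := fun x => hb ⟨x, rfl⟩
  have hbdd : BddBelow (M '' {x | H x = 0}) := ⟨b, by rintro _ ⟨x, -, rfl⟩; exact hbM x⟩
  refine tendsto_order.2 ⟨fun c' hc' => ?_, fun c hc => ?_⟩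
  · obtain ⟨c, hc'c, hc⟩ := exists_between hc'
    obtain ⟨δ, hδ, hle⟩ := exists_pos_le_of_sublevel hM hH (c := c) fun x hx =>
      (hH0 x).lt_of_ne' fun h => (hc.trans_le (csInf_le hbdd ⟨x, h, rfl⟩)).not_ge hx
    have hlarge : ∀ᶠ ε in nhdsWithin (0 : ℝ) (Set.Ioi 0), c - b ≤ δ * ε⁻¹ :=
      (tendsto_inv_nhdsGT_zero.const_mul_atTop hδ).eventually_ge_atTop _
    filter_upwards [hlarge, self_mem_nhdsWithin] with ε hε (hε0 : 0 < ε)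
    refine hc'c.trans_le (le_ciInf fun x => ?_)
    rcases le_or_gt (M x) c with hx | hx
    · have : δ * ε⁻¹ ≤ H x / ε := by
        rw [← div_eq_mul_inv]
        exact div_le_div_of_nonneg_right (hle x hx) hε0.le
      linarith [hbM x]
    · linarith [div_nonneg (hH0 x) hε0.le]
  · filter_upwards [self_mem_nhdsWithin] with ε (hε0 : 0 < ε)
    obtain ⟨_, ⟨x, hx : H x = 0, rfl⟩, hxc⟩ := exists_lt_of_csInf_lt (hne.image M) hc
    have hbddF : BddBelow (Set.range fun x => M x + H x / ε) :=
      ⟨b, by rintro _ ⟨y, rfl⟩; exact le_add_of_le_of_nonneg (hbM y) (div_nonneg (hH0 y) hε0.le)⟩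
    exact (ciInf_le hbddF x).trans_lt (by simpa [hx] using hxc)
end

section
/- Let X be a topological space and let M, H : X → ℝ be lower semicontinuous functions with M bounded below, H(x) ≥ 0 for all x, and suppose there exists z ∈ X with H(z) = 0. Let ε_i > 0 be a sequence with ε_i → 0, let x_i ∈ X minimize F_{ε_i} := M + (1/ε_i)H over X, and suppose x_i → x₀ in X. Then the rescaled penalty terms vanish in the limit: H(x_i)/ε_i → 0 as i → ∞. -/
/-- Along a convergent sequence of minimizers of the penalized functionals
`F_ε = M + H/ε`, the rescaled penalty terms `H(x_i)/ε_i` tend to `0`. -/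
theorem penalty_terms_vanish {X : Type*} [TopologicalSpace X]
    (M H : X → ℝ) (hM : LowerSemicontinuous M) (hH : LowerSemicontinuous H)
    (hMbd : BddBelow (Set.range M)) (hH0 : ∀ x, 0 ≤ H x)
    (hz : ∃ z, H z = 0)
    (ε : ℕ → ℝ) (hε : ∀ i, 0 < ε i)
    (hε0 : Filter.Tendsto ε Filter.atTop (nhds 0))
    (x : ℕ → X)
    (hmin : ∀ i, ∀ y, M (x i) + H (x i) / ε i ≤ M y + H y / ε i)
    (x₀ : X) (hx : Filter.Tendsto x Filter.atTop (nhds x₀)) :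
    Filter.Tendsto (fun i => H (x i) / ε i) Filter.atTop (nhds 0) := by
  obtain ⟨z, hz⟩ := hz
  obtain ⟨m, hm⟩ := hMbd
  have H_le : ∀ i, H (x i) ≤ ε i * (M z - m) := fun i => by
    have h := hmin i z
    have hmi : m ≤ M (x i) := hm ⟨x i, rfl⟩
    rw [hz, zero_div] at h
    rw [mul_comm, ← div_le_iff₀ (hε i)]
    linarith
  have bound_tendsto : Filter.Tendsto (fun i => ε i * (M z - m)) Filter.atTop (nhds 0) := by
    simpa using hε0.mul_const (M z - m)
  have hHx₀ : H x₀ = 0 := by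
    refine le_antisymm (not_lt.mp fun hpos => ?_) (hH0 x₀)
    obtain ⟨i, hi, hi'⟩ := ((hx.eventually (hH x₀ (H x₀ / 2) (by linarith))).and
      (bound_tendsto.eventually_lt_const (half_pos hpos))).exists
    linarith [H_le i]
  refine tendsto_order.2 ⟨fun a ha => .of_forall fun i =>
    ha.trans_le (div_nonneg (hH0 _) (hε i).le), fun δ hδ => ?_⟩
  filter_upwards [hx.eventually (hM x₀ (M x₀ - δ) (by linarith))] with i hi
  have h := hmin i x₀
  rw [hHx₀, zero_div] at h
  linarith
end

section
/- Let n be a positive integer, let R > 0, and let f : ℝ → ℝ be nonnegative and monotone nondecreasing on the interval (0, R). Suppose that for Lebesgue-almost every r ∈ (0, R), f is differentiable at r and n · f(r) ≤ r · f'(r). Then the function r ↦ f(r)/rⁿ is monotone nondecreasing on (0, R). -/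
open MeasureTheory

/-- On an interval where `c / r ≤ g' r` almost everywhere, a monotone function `g` grows by at least
`c * log (y / x)`. -/
theorem MonotoneOn.mul_log_div_le_sub {g : ℝ → ℝ} {c x y : ℝ} (hx : 0 < x) (hxy : x ≤ y)
    (hg : MonotoneOn g (Set.Icc x y))
    (hd : ∀ᵐ r ∂(volume.restrict (Set.Icc x y)), c / r ≤ deriv g r) :
    c * Real.log (y / x) ≤ g y - g x := by
  have hy : 0 < y := hx.trans_le hxy
  have hg' : MonotoneOn g (Set.uIcc x y) := by rwa [Set.uIcc_of_le hxy]
  have hle : ∫ r in x..y, deriv g r ≤ g y - g x := by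
    have h := hg'.intervalIntegral_deriv_mem_uIcc
    rw [Set.uIcc_of_le (sub_nonneg.2 (hg (Set.left_mem_Icc.2 hxy) (Set.right_mem_Icc.2 hxy) hxy))]
      at h
    exact h.2
  have hci : IntervalIntegrable (fun r : ℝ => c / r) volume x y := by
    refine ContinuousOn.intervalIntegrable fun r hr => ?_
    rw [Set.uIcc_of_le hxy] at hr
    exact (continuousAt_const.div continuousAt_id (hx.trans_le hr.1).ne').continuousWithinAt
  calc c * Real.log (y / x) = ∫ r in x..y, c / r := by
        simp only [div_eq_mul_inv c, intervalIntegral.integral_const_mul,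
          integral_inv_of_pos hx hy]
    _ ≤ ∫ r in x..y, deriv g r :=
        intervalIntegral.integral_mono_ae_restrict hxy hci hg'.intervalIntegrable_deriv hd
    _ ≤ g y - g x := hle

/-- Iterating a multiplicative lower bound `φ s * (1 + c * (t - s)) ≤ φ t` gives exponential
growth. -/
theorem mul_exp_le_of_mul_one_add_le {φ : ℝ → ℝ} {c L : ℝ} (hc : 0 ≤ c) (hL : 0 ≤ L)
    (hφ : ∀ s t, 0 ≤ s → s ≤ t → t ≤ L → φ s * (1 + c * (t - s)) ≤ φ t) :
    φ 0 * Real.exp (c * L) ≤ φ L := by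
  refine le_of_tendsto ((Real.tendsto_one_add_div_pow_exp (c * L)).const_mul (φ 0)) ?_
  filter_upwards [Filter.eventually_gt_atTop 0] with k hk
  have hk' : (0 : ℝ) < k := by exact_mod_cast hk
  have key : ∀ i : ℕ, i ≤ k → φ 0 * (1 + c * L / k) ^ i ≤ φ (i * (L / k)) := by
    intro i
    induction i with
    | zero => simp
    | succ i ih =>
      intro hi
      have hstep := hφ (i * (L / k)) ((i + 1 : ℕ) * (L / k)) (by positivity)
        (by gcongr; simp) (by
          calc ((i + 1 : ℕ) : ℝ) * (L / k) ≤ k * (L / k) := by gcongr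
            _ = L := by field_simp)
      calc φ 0 * (1 + c * L / k) ^ (i + 1) = φ 0 * (1 + c * L / k) ^ i * (1 + c * L / k) := by ring
        _ ≤ φ (i * (L / k)) * (1 + c * L / k) := by gcongr; exact ih (by omega)
        _ = φ (i * (L / k)) * (1 + c * ((i + 1 : ℕ) * (L / k) - i * (L / k))) := by
            push_cast; ring
        _ ≤ _ := hstep
  have h := key k le_rfl
  rwa [mul_div_cancel₀ L hk'.ne'] at h

/-- Monotonicity of the mass ratio: if `f ≥ 0` is nondecreasing on `(0,R)` and
satisfies `n·f(r) ≤ r·f'(r)` at a.e. point of differentiability, then `f(r)/rⁿ`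
is nondecreasing on `(0,R)`. -/
theorem mass_ratio_monotone (n : ℕ) (hn : 0 < n) (R : ℝ) (hR : 0 < R)
    (f : ℝ → ℝ) (hf0 : ∀ r ∈ Set.Ioo (0 : ℝ) R, 0 ≤ f r)
    (hfmono : MonotoneOn f (Set.Ioo (0 : ℝ) R))
    (hae : ∀ᵐ r ∂(volume.restrict (Set.Ioo (0 : ℝ) R)),
      DifferentiableAt ℝ f r ∧ (n : ℝ) * f r ≤ r * deriv f r) :
    MonotoneOn (fun r => f r / r ^ n) (Set.Ioo (0 : ℝ) R) := by
  have hlog : ∀ x y, 0 < x → x ≤ y → y < R → f x * (1 + n * Real.log (y / x)) ≤ f y := by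
    intro x y hx hxy hyR
    have hsub : Set.Icc x y ⊆ Set.Ioo 0 R := fun r hr => ⟨hx.trans_le hr.1, hr.2.trans_lt hyR⟩
    have h := (hfmono.mono hsub).mul_log_div_le_sub (c := n * f x) hx hxy (by
      filter_upwards [ae_restrict_of_ae_restrict_of_subset hsub hae,
        ae_restrict_mem measurableSet_Icc] with r hr hrm
      rw [div_le_iff₀' (hsub hrm).1]
      refine le_trans ?_ hr.2
      gcongr
      exact hfmono (hsub (Set.left_mem_Icc.2 hxy)) (hsub hrm) hrm.1)
    linarith
  intro a ha b hb hab
  have hL : 0 ≤ Real.log (b / a) := Real.log_nonneg ((one_le_div ha.1).2 hab)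
  have hexp : a * Real.exp (Real.log (b / a)) = b := by
    rw [Real.exp_log (div_pos hb.1 ha.1), mul_div_cancel₀ b ha.1.ne']
  have h := mul_exp_le_of_mul_one_add_le (φ := fun t => f (a * Real.exp t)) n.cast_nonneg hL (by
    intro s t _ hst htL
    have ha' := ha.1
    have hbound : a * Real.exp t ≤ b := by
      rw [← hexp]
      gcongr
    have h := hlog (a * Real.exp s) (a * Real.exp t) (by positivity) (by gcongr)
      (hbound.trans_lt hb.2)
    rwa [mul_div_mul_left _ _ ha'.ne', ← Real.exp_sub, Real.log_exp] at h)
  simp only [Real.exp_zero, mul_one, hexp] at h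
  rw [Real.exp_nat_mul, Real.exp_log (div_pos hb.1 ha.1)] at h
  change f a / a ^ n ≤ f b / b ^ n
  rw [le_div_iff₀ (pow_pos hb.1 n)]
  calc f a / a ^ n * b ^ n = f a * (b / a) ^ n := by rw [div_pow]; ring
    _ ≤ f b := h
end

section
/- Let n ≥ 1 be an integer, let 0 < θ ≤ 1, and let p be a real number with 1 ≤ p < n/(n−1). There is a constant τ = τ(n, θ, p) > 0 with the following property: for every R > 0, every x₀ ∈ ℝⁿ, every Lebesgue-measurable set A ⊆ B(x₀, R) with meas(A) ≥ θ · meas(B(x₀, R)), and every continuously differentiable function h : ℝⁿ → ℝ with ∫_A h dLⁿ = 0, one has (R^{−n} ∫_{B(x₀,R)} |h|^p dLⁿ)^{1/p} ≤ τ · R^{1−n} · ∫_{B(x₀,R)} ‖∇h‖ dLⁿ. -/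
open MeasureTheory
open scoped ENNReal

section Potential

variable {E : Type*} [NormedAddCommGroup E] [NormedSpace ℝ E]

/-- The increment of a `C¹` function is bounded by the integral of its derivative along a segment. -/
theorem enorm_sub_le_lintegral_fderiv_segment {h : E → ℝ} (hh : ContDiff ℝ 1 h) (x y : E) :
    ‖h x - h y‖ₑ ≤ ∫⁻ t in Set.Ioc (0 : ℝ) 1,
      ‖fderiv ℝ h (x + t • (y - x))‖ₑ * ‖y - x‖ₑ := by
  have hγ : ∀ t : ℝ, HasDerivAt (fun t : ℝ ↦ h (x + t • (y - x)))
      (fderiv ℝ h (x + t • (y - x)) (y - x)) t := by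
    intro t
    have h1 : HasDerivAt (fun t : ℝ ↦ x + t • (y - x)) (y - x) t := by
      simpa using ((hasDerivAt_id t).smul_const (y - x)).const_add x
    exact ((hh.differentiable one_ne_zero _).hasFDerivAt).comp_hasDerivAt t h1
  have hc : Continuous fun t : ℝ ↦ fderiv ℝ h (x + t • (y - x)) (y - x) :=
    ((hh.continuous_fderiv one_ne_zero).comp (by fun_prop)).clm_apply continuous_const
  have hftc := intervalIntegral.integral_eq_sub_of_hasDerivAt (fun t _ ↦ hγ t)
    (hc.intervalIntegrable 0 1)
  have : h y - h x = ∫ t in Set.Ioc (0 : ℝ) 1, fderiv ℝ h (x + t • (y - x)) (y - x) := by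
    rw [← intervalIntegral.integral_of_le zero_le_one, hftc]
    simp
  rw [← enorm_neg, neg_sub, this]
  exact (enorm_integral_le_lintegral_enorm _).trans
    (lintegral_mono fun t ↦ ContinuousLinearMap.le_opENorm _ _)

theorem lintegral_Ioc_indicator_rpow_le {d D r : ℝ} (hd : 0 < d) (hD : 0 < D) (hr : 0 ≤ r) :
    ENNReal.ofReal r * ∫⁻ t in Set.Ioc (0 : ℝ) 1,
        {t | r < D * t}.indicator (fun t ↦ ENNReal.ofReal (t ^ (-d - 1))) t ≤
      ENNReal.ofReal (D ^ d / d) * ENNReal.ofReal (r ^ (1 - d)) := by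
  rcases hr.eq_or_lt with rfl | hr
  · simp
  have hc : 0 < r / D := div_pos hr hD
  calc
    _ ≤ ENNReal.ofReal r * ∫⁻ t in Set.Ioi (r / D), ENNReal.ofReal (t ^ (-d - 1)) := by
        gcongr ENNReal.ofReal r * ?_
        rw [lintegral_indicator (measurableSet_lt (by fun_prop) (by fun_prop))]
        rw [Measure.restrict_restrict (measurableSet_lt (by fun_prop) (by fun_prop))]
        refine lintegral_mono_set fun t ht ↦ ?_
        rw [Set.mem_Ioi, div_lt_iff₀' hD]
        exact ht.1
    _ = ENNReal.ofReal r * ENNReal.ofReal ((r / D) ^ (-d) / d) := by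
        rw [← ofReal_integral_eq_lintegral_ofReal
          (integrableOn_Ioi_rpow_of_lt (by linarith) hc)]
        · rw [integral_Ioi_rpow_of_lt (by linarith) hc]
          congr 2
          rw [sub_add_cancel, neg_div_neg_eq]
        · filter_upwards [self_mem_ae_restrict measurableSet_Ioi] with t ht
          exact Real.rpow_nonneg (hc.trans ht).le _
    _ = _ := by
        rw [← ENNReal.ofReal_mul hr.le, ← ENNReal.ofReal_mul (by positivity)]
        congr 1
        rw [Real.div_rpow hr.le hD.le, Real.rpow_neg hD.le, Real.rpow_sub hr, Real.rpow_neg hr.le,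
          Real.rpow_one]
        field_simp

variable [FiniteDimensional ℝ E] [MeasurableSpace E] [BorelSpace E]
  (μ : Measure E) [μ.IsAddHaarMeasure]

/-- Change of variables for the homothety with center `x` and ratio `t`. -/
theorem lintegral_comp_add_smul_sub (φ : E → ℝ≥0∞) (x : E) {t : ℝ} (ht : 0 < t) :
    ∫⁻ y, φ (x + t • (y - x)) ∂μ =
      ENNReal.ofReal (t ^ (-(Module.finrank ℝ E : ℝ))) * ∫⁻ z, φ z ∂μ := by
  rw [lintegral_sub_right_eq_self (fun y ↦ φ (x + t • y)) x]
  have he : MeasurableEmbedding fun y : E ↦ t • y :=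
    (Homeomorph.smulOfNeZero t ht.ne').measurableEmbedding
  rw [← he.lintegral_map (fun y ↦ φ (x + y)) ,
    Measure.map_addHaar_smul μ ht.ne', lintegral_smul_measure, lintegral_add_left_eq_self φ x,
    Real.rpow_neg ht.le, Real.rpow_natCast, abs_of_pos (by positivity), smul_eq_mul]

/-- On a convex set, the total oscillation of `h` around `h x` is bounded by the Riesz potential of
the norm of its derivative. -/
theorem lintegral_enorm_sub_le_riesz_potential [Nontrivial E] {h : E → ℝ} (hh : ContDiff ℝ 1 h)
    {s : Set E} (hs : MeasurableSet s) (hconv : Convex ℝ s) {D : ℝ} (hD : 0 < D)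
    {x : E} (hx : x ∈ s) (hdiam : ∀ y ∈ s, ‖y - x‖ < D) :
    ∫⁻ y in s, ‖h x - h y‖ₑ ∂μ ≤
      ENNReal.ofReal (D ^ (Module.finrank ℝ E : ℝ) / Module.finrank ℝ E) *
        ∫⁻ z in s, ‖fderiv ℝ h z‖ₑ *
          ENNReal.ofReal (‖z - x‖ ^ (1 - (Module.finrank ℝ E : ℝ))) ∂μ := by
  set d : ℝ := (Module.finrank ℝ E : ℝ)
  have hd : 0 < d := Nat.cast_pos.2 Module.finrank_pos
  have hG : Continuous (fderiv ℝ h) := hh.continuous_fderiv one_ne_zero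
  let ψ : ℝ → E → ℝ≥0∞ := fun t z ↦ ‖fderiv ℝ h z‖ₑ * (ENNReal.ofReal ‖z - x‖ *
    {t | ‖z - x‖ < D * t}.indicator (fun t ↦ ENNReal.ofReal (t ^ (-d - 1))) t)
  have hψ : Measurable (Function.uncurry ψ) := by
    have : Measurable fun q : ℝ × E ↦ {q : ℝ × E | ‖q.2 - x‖ < D * q.1}.indicator
        (fun q ↦ ENNReal.ofReal (q.1 ^ (-d - 1))) q :=
      Measurable.indicator (by fun_prop) (measurableSet_lt (by fun_prop) (by fun_prop))
    exact (hG.comp continuous_snd).enorm.measurable.mul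
      (Measurable.mul (by fun_prop) this)
  calc
    _ ≤ ∫⁻ y in s, (∫⁻ t in Set.Ioc (0 : ℝ) 1,
          ‖fderiv ℝ h (x + t • (y - x))‖ₑ * ‖y - x‖ₑ) ∂μ :=
        lintegral_mono fun y ↦ enorm_sub_le_lintegral_fderiv_segment hh x y
    _ = ∫⁻ t in Set.Ioc (0 : ℝ) 1, (∫⁻ y in s,
          ‖fderiv ℝ h (x + t • (y - x))‖ₑ * ‖y - x‖ₑ ∂μ) := by
        refine lintegral_lintegral_swap (Measurable.aemeasurable ?_)
        have hline : Continuous fun q : E × ℝ ↦ x + q.2 • (q.1 - x) := by fun_prop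
        exact (hG.comp hline).enorm.measurable.mul (by fun_prop)
    _ ≤ ∫⁻ t in Set.Ioc (0 : ℝ) 1, (∫⁻ z in s, ψ t z ∂μ) := by
        refine setLIntegral_mono' measurableSet_Ioc fun t ht ↦ ?_
        let φ : E → ℝ≥0∞ := s.indicator fun z ↦ ENNReal.ofReal (t ^ d) * ψ t z
        have hφ : ∫⁻ z, φ z ∂μ = ENNReal.ofReal (t ^ d) * ∫⁻ z in s, ψ t z ∂μ := by
          rw [lintegral_indicator hs, lintegral_const_mul]
          exact hψ.of_uncurry_left
        have key : ∀ y ∈ s, ‖fderiv ℝ h (x + t • (y - x))‖ₑ * ‖y - x‖ₑ ≤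
            φ (x + t • (y - x)) := by
          intro y hy
          have hmem : x + t • (y - x) ∈ s := hconv.add_smul_sub_mem hx hy ⟨ht.1.le, ht.2⟩
          have hn : ‖x + t • (y - x) - x‖ = t * ‖y - x‖ := by
            rw [add_sub_cancel_left, norm_smul, Real.norm_of_nonneg ht.1.le]
          have hlt : t * ‖y - x‖ < D * t := by
            rw [mul_comm D]
            exact mul_lt_mul_of_pos_left (hdiam y hy) ht.1
          simp only [φ, ψ, Set.indicator_of_mem hmem, hn]
          rw [Set.indicator_of_mem (by exact hlt), ← mul_assoc, mul_comm (ENNReal.ofReal (t ^ d)),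
            mul_assoc]
          gcongr
          rw [← ofReal_norm, ← ENNReal.ofReal_mul (by have := ht.1; positivity),
            ← ENNReal.ofReal_mul (by have := ht.1; positivity)]
          apply le_of_eq
          congr 1
          have := ht.1
          rw [Real.rpow_sub this, Real.rpow_neg this.le, Real.rpow_one]
          field_simp
        calc
          _ ≤ ∫⁻ y in s, φ (x + t • (y - x)) ∂μ := setLIntegral_mono' hs key
          _ ≤ ∫⁻ y, φ (x + t • (y - x)) ∂μ := setLIntegral_le_lintegral _ _
          _ = ∫⁻ z in s, ψ t z ∂μ := by
            rw [lintegral_comp_add_smul_sub μ φ x ht.1, hφ, ← mul_assoc, ← ENNReal.ofReal_mul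
              (Real.rpow_nonneg ht.1.le _), ← Real.rpow_add ht.1]
            simp [d]
    _ = ∫⁻ z in s, (∫⁻ t in Set.Ioc (0 : ℝ) 1, ψ t z) ∂μ :=
        lintegral_lintegral_swap hψ.aemeasurable
    _ ≤ ∫⁻ z in s, ENNReal.ofReal (D ^ d / d) * (‖fderiv ℝ h z‖ₑ *
          ENNReal.ofReal (‖z - x‖ ^ (1 - d))) ∂μ := by
        refine lintegral_mono fun z ↦ ?_
        have hm : Measurable ({t | ‖z - x‖ < D * t}.indicator
            fun t ↦ ENNReal.ofReal (t ^ (-d - 1))) :=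
          Measurable.indicator (by fun_prop) (measurableSet_lt (by fun_prop) (by fun_prop))
        simp only [ψ]
        rw [lintegral_const_mul _ (hm.const_mul _), lintegral_const_mul _ hm]
        rw [mul_left_comm (ENNReal.ofReal (D ^ d / d))]
        gcongr ‖fderiv ℝ h z‖ₑ * ?_
        exact lintegral_Ioc_indicator_rpow_le hd hD (norm_nonneg (z - x))
    _ = _ := by
        rw [lintegral_const_mul]
        exact hG.enorm.measurable.mul (by fun_prop)

/-- Jensen's inequality for the measure with density `g`, unnormalized. -/
theorem ENNReal.lintegral_mul_rpow_le {α : Type*} [MeasurableSpace α] {ν : Measure α}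
    {g k : α → ℝ≥0∞} (hg : Measurable g) (hk : Measurable k) {p : ℝ} (hp : 1 ≤ p) :
    (∫⁻ a, g a * k a ∂ν) ^ p ≤ (∫⁻ a, g a ∂ν) ^ (p - 1) * ∫⁻ a, g a * k a ^ p ∂ν := by
  have hp0 : 0 < p := by linarith
  have := eLpNorm'_le_eLpNorm'_mul_rpow_measure_univ (μ := ν.withDensity g) zero_lt_one hp
    hk.aestronglyMeasurable
  simp only [eLpNorm'_eq_lintegral_enorm, enorm_eq_self, ENNReal.rpow_one, div_one] at this
  rw [lintegral_withDensity_eq_lintegral_mul _ hg hk,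
    lintegral_withDensity_eq_lintegral_mul _ hg (hk.pow_const p), withDensity_apply _ .univ,
    Measure.restrict_univ] at this
  calc
    _ ≤ _ := ENNReal.rpow_le_rpow this hp0.le
    _ = _ := by
      rw [ENNReal.mul_rpow_of_nonneg _ _ hp0.le, ← ENNReal.rpow_mul, ← ENNReal.rpow_mul, mul_comm]
      congr 2
      · field_simp
      · rw [one_div_mul_cancel hp0.ne', ENNReal.rpow_one]
        rfl

theorem lintegral_ball_rpow_norm_lt_top [Nontrivial E] {a r : ℝ} (ha : a < Module.finrank ℝ E) :
    ∫⁻ x in Metric.ball (0 : E) r, ENNReal.ofReal (‖x‖ ^ (-a)) ∂μ < ∞ := by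
  have hint : IntegrableOn (fun x : E ↦ ‖x‖ ^ (-a)) (Metric.ball 0 r) μ := by
    refine integrableOn_ball_of_norm_le_rpow (C := 1) Module.finrank_pos ha
      (.of_forall fun x ↦ ?_)
      (measurable_norm.pow_const (-a)).aestronglyMeasurable
    rw [one_mul, Real.norm_of_nonneg (by positivity)]
  exact hint.lintegral_lt_top

theorem exists_lintegral_unitBall_rpow_le [Nontrivial E] {θ p : ℝ} (hθ : 0 < θ) (hp : 1 ≤ p)
    (hpd : p * ((Module.finrank ℝ E : ℝ) - 1) < Module.finrank ℝ E) :
    ∃ K : ℝ≥0∞, K ≠ ∞ ∧ ∀ A : Set E, MeasurableSet A → A ⊆ Metric.ball 0 1 →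
      ENNReal.ofReal θ * μ (Metric.ball 0 1) ≤ μ A →
      ∀ h : E → ℝ, ContDiff ℝ 1 h → ∫ x in A, h x ∂μ = 0 →
      (∫⁻ x in Metric.ball 0 1, ‖h x‖ₑ ^ p ∂μ) ^ (1 / p) ≤
        K * ∫⁻ x in Metric.ball 0 1, ‖fderiv ℝ h x‖ₑ ∂μ := by
  have hp0 : 0 < p := by linarith
  set d : ℝ := (Module.finrank ℝ E : ℝ)
  set B : Set E := Metric.ball 0 1
  set c : ℝ≥0∞ := ENNReal.ofReal (2 ^ d / d)
  set m : ℝ≥0∞ := ENNReal.ofReal θ * μ B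
  set M : ℝ≥0∞ := ∫⁻ x in Metric.ball (0 : E) 2, ENNReal.ofReal (‖x‖ ^ (1 - d)) ^ p ∂μ
  have hM : M < ∞ := by
    refine lt_of_eq_of_lt (lintegral_congr fun x ↦ ?_)
      (lintegral_ball_rpow_norm_lt_top μ (r := 2) hpd)
    rw [ENNReal.ofReal_rpow_of_nonneg (by positivity) hp0.le, ← Real.rpow_mul (norm_nonneg _)]
    congr 2
    ring
  have hm0 : m ≠ 0 :=
    mul_ne_zero (by simpa using hθ) (Metric.measure_ball_pos μ _ one_pos).ne'
  have hmtop : m ≠ ∞ := ENNReal.mul_ne_top ENNReal.ofReal_ne_top measure_ball_lt_top.ne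
  refine ⟨m⁻¹ * (c * M ^ (1 / p)), ENNReal.mul_ne_top (ENNReal.inv_ne_top.2 hm0)
    (ENNReal.mul_ne_top ENNReal.ofReal_ne_top
      (ENNReal.rpow_ne_top_of_nonneg (by positivity) hM.ne)), ?_⟩
  intro A hA hAB hmA h hh hA0
  have hG : Measurable fun z ↦ ‖fderiv ℝ h z‖ₑ :=
    (hh.continuous_fderiv one_ne_zero).enorm.measurable
  set I : ℝ≥0∞ := ∫⁻ x in B, ‖fderiv ℝ h x‖ₑ ∂μ
  let k : E → E → ℝ≥0∞ := fun x z ↦ ENNReal.ofReal (‖z - x‖ ^ (1 - d))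
  have hkm : Measurable fun q : E × E ↦ ‖fderiv ℝ h q.2‖ₑ * k q.1 q.2 ^ p :=
    (hG.comp measurable_snd).mul (by fun_prop)
  have hAfin : μ A ≠ ∞ := ((measure_mono hAB).trans_lt measure_ball_lt_top).ne
  have hAint : IntegrableOn h A μ :=
    (hh.continuous.continuousOn.integrableOn_compact (isCompact_closedBall (0 : E) 1)).mono_set
      (hAB.trans Metric.ball_subset_closedBall)
  have hpt : ∀ x ∈ B, m * ‖h x‖ₑ ≤ c * ∫⁻ z in B, ‖fderiv ℝ h z‖ₑ * k x z ∂μ := by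
    intro x hx
    have hmean : ∫ y in A, (h x - h y) ∂μ = μ.real A * h x := by
      have hconst : IntegrableOn (fun _ ↦ h x) A μ := integrableOn_const hAfin
      rw [integral_sub hconst hAint, hA0]
      simp
    calc
      m * ‖h x‖ₑ ≤ μ A * ‖h x‖ₑ := by gcongr
      _ = ‖∫ y in A, (h x - h y) ∂μ‖ₑ := by
        rw [hmean, enorm_mul, Real.enorm_of_nonneg measureReal_nonneg, ofReal_measureReal hAfin]
      _ ≤ ∫⁻ y in A, ‖h x - h y‖ₑ ∂μ := enorm_integral_le_lintegral_enorm _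
      _ ≤ ∫⁻ y in B, ‖h x - h y‖ₑ ∂μ := lintegral_mono_set hAB
      _ ≤ _ := by
        refine lintegral_enorm_sub_le_riesz_potential μ hh measurableSet_ball
          (convex_ball _ _) two_pos hx fun y hy ↦ ?_
        have := norm_sub_le y x
        have := mem_ball_zero_iff.1 hx
        have := mem_ball_zero_iff.1 hy
        linarith
  have hker : ∀ z ∈ B, ∫⁻ x in B, k x z ^ p ∂μ ≤ M := by
    intro z hz
    let f : E → ℝ≥0∞ := (Metric.ball (0 : E) 2).indicator fun x ↦
      ENNReal.ofReal (‖x‖ ^ (1 - d)) ^ p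
    calc
      _ ≤ ∫⁻ x in B, f (z - x) ∂μ := by
        refine setLIntegral_mono' measurableSet_ball fun x hx ↦ ?_
        have hmem : z - x ∈ Metric.ball (0 : E) 2 := by
          have := norm_sub_le z x
          have := mem_ball_zero_iff.1 hx
          have := mem_ball_zero_iff.1 hz
          rw [mem_ball_zero_iff]
          linarith
        simp only [f, Set.indicator_of_mem hmem, k, le_refl]
      _ ≤ ∫⁻ x, f (z - x) ∂μ := setLIntegral_le_lintegral _ _
      _ = M := by
        rw [lintegral_sub_left_eq_self f z, lintegral_indicator measurableSet_ball]
  have hpow : m ^ p * ∫⁻ x in B, ‖h x‖ₑ ^ p ∂μ ≤ c ^ p * (I ^ p * M) := by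
    calc
      _ = ∫⁻ x in B, (m * ‖h x‖ₑ) ^ p ∂μ := by
        rw [← lintegral_const_mul _ (hh.continuous.enorm.measurable.pow_const p)]
        simp_rw [ENNReal.mul_rpow_of_nonneg _ _ hp0.le]
      _ ≤ ∫⁻ x in B, c ^ p * (I ^ (p - 1) * ∫⁻ z in B, ‖fderiv ℝ h z‖ₑ * k x z ^ p ∂μ) ∂μ := by
        refine setLIntegral_mono' measurableSet_ball fun x hx ↦ ?_
        refine (ENNReal.rpow_le_rpow (hpt x hx) hp0.le).trans ?_
        rw [ENNReal.mul_rpow_of_nonneg _ _ hp0.le]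
        gcongr
        exact ENNReal.lintegral_mul_rpow_le hG (by fun_prop) hp
      _ = c ^ p * (I ^ (p - 1) *
          ∫⁻ x in B, (∫⁻ z in B, ‖fderiv ℝ h z‖ₑ * k x z ^ p ∂μ) ∂μ) := by
        rw [lintegral_const_mul _ (hkm.lintegral_prod_right'.const_mul _),
          lintegral_const_mul _ hkm.lintegral_prod_right']
      _ = c ^ p * (I ^ (p - 1) *
          ∫⁻ z in B, (∫⁻ x in B, ‖fderiv ℝ h z‖ₑ * k x z ^ p ∂μ) ∂μ) := by
        rw [lintegral_lintegral_swap hkm.aemeasurable]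
      _ ≤ c ^ p * (I ^ (p - 1) * ∫⁻ z in B, ‖fderiv ℝ h z‖ₑ * M ∂μ) := by
        gcongr c ^ p * (I ^ (p - 1) * ?_)
        refine setLIntegral_mono' measurableSet_ball fun z hz ↦ ?_
        rw [lintegral_const_mul _ (by fun_prop)]
        gcongr
        exact hker z hz
      _ = c ^ p * (I ^ p * M) := by
        rw [lintegral_mul_const _ hG, ← mul_assoc (I ^ (p - 1))]
        congr 2
        have := ENNReal.rpow_add_of_nonneg (x := I) (p - 1) 1 (by linarith) zero_le_one
        rw [sub_add_cancel, ENNReal.rpow_one] at this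
        exact this.symm
  have hroot := ENNReal.rpow_le_rpow hpow (one_div_nonneg.2 hp0.le)
  simp only [ENNReal.mul_rpow_of_nonneg _ _ (one_div_nonneg.2 hp0.le), ← ENNReal.rpow_mul,
    mul_one_div_cancel hp0.ne', ENNReal.rpow_one] at hroot
  rw [mul_assoc, ← ENNReal.mul_le_iff_le_inv hm0 hmtop]
  refine hroot.trans_eq ?_
  ring

end Potential

/-- The Poincaré-type inequality on the unit ball. -/
theorem exists_integral_unitBall_rpow_le {E : Type*} [NormedAddCommGroup E] [NormedSpace ℝ E]
    [FiniteDimensional ℝ E] [MeasurableSpace E] [BorelSpace E] (μ : Measure E)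
    [μ.IsAddHaarMeasure] [Nontrivial E] {θ p : ℝ} (hθ : 0 < θ) (hp : 1 ≤ p)
    (hpd : p * ((Module.finrank ℝ E : ℝ) - 1) < Module.finrank ℝ E) :
    ∃ τ : ℝ, 0 < τ ∧ ∀ A : Set E, MeasurableSet A → A ⊆ Metric.ball 0 1 →
      θ * μ.real (Metric.ball 0 1) ≤ μ.real A →
      ∀ h : E → ℝ, ContDiff ℝ 1 h → ∫ x in A, h x ∂μ = 0 →
      (∫ x in Metric.ball 0 1, |h x| ^ p ∂μ) ^ (1 / p) ≤
        τ * ∫ x in Metric.ball 0 1, ‖fderiv ℝ h x‖ ∂μ := by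
  have hp0 : 0 < p := by linarith
  obtain ⟨K, hK, H⟩ := exists_lintegral_unitBall_rpow_le μ hθ hp hpd
  refine ⟨K.toReal + 1, by positivity, fun A hA hAB hmA h hh hA0 ↦ ?_⟩
  have hint : ∀ f : E → ℝ, Continuous f → IntegrableOn f (Metric.ball 0 1) μ := fun f hf ↦
    (hf.continuousOn.integrableOn_compact (isCompact_closedBall (0 : E) 1)).mono_set
      Metric.ball_subset_closedBall
  have hGi := hint _ (hh.continuous_fderiv one_ne_zero).norm
  have hpi := hint _ (hh.continuous.abs.rpow_const fun _ ↦ .inr hp0.le)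
  have hm : ENNReal.ofReal θ * μ (Metric.ball 0 1) ≤ μ A := by
    have hA' : μ A ≠ ∞ := ((measure_mono hAB).trans_lt measure_ball_lt_top).ne
    rw [← ofReal_measureReal hA', ← ofReal_measureReal (measure_ball_lt_top (μ := μ)).ne,
      ← ENNReal.ofReal_mul hθ.le]
    exact ENNReal.ofReal_le_ofReal hmA
  have h1 := H A hA hAB hm h hh hA0
  have hl : ∫⁻ x in Metric.ball 0 1, ‖h x‖ₑ ^ p ∂μ =
      ENNReal.ofReal (∫ x in Metric.ball 0 1, |h x| ^ p ∂μ) := by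
    rw [ofReal_integral_eq_lintegral_ofReal hpi (.of_forall fun x ↦ by positivity)]
    refine lintegral_congr fun x ↦ ?_
    rw [← ofReal_norm, Real.norm_eq_abs, ENNReal.ofReal_rpow_of_nonneg (abs_nonneg _) hp0.le]
  have hr : ∫⁻ x in Metric.ball 0 1, ‖fderiv ℝ h x‖ₑ ∂μ =
      ENNReal.ofReal (∫ x in Metric.ball 0 1, ‖fderiv ℝ h x‖ ∂μ) := by
    rw [ofReal_integral_eq_lintegral_ofReal hGi (.of_forall fun x ↦ norm_nonneg _)]
    simp_rw [ofReal_norm]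
  have hnn : 0 ≤ ∫ x in Metric.ball 0 1, ‖fderiv ℝ h x‖ ∂μ :=
    integral_nonneg fun _ ↦ norm_nonneg _
  rw [hl, hr, ENNReal.ofReal_rpow_of_nonneg (integral_nonneg fun x ↦ by positivity)
    (by positivity), ← ENNReal.ofReal_toReal hK, ← ENNReal.ofReal_mul ENNReal.toReal_nonneg,
    ENNReal.ofReal_le_ofReal_iff (by positivity)] at h1
  refine h1.trans ?_
  gcongr
  linarith

theorem setIntegral_preimage_add_smul {E F : Type*} [NormedAddCommGroup E] [NormedSpace ℝ E]
    [FiniteDimensional ℝ E] [MeasurableSpace E] [BorelSpace E] (μ : Measure E)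
    [μ.IsAddHaarMeasure] [NormedAddCommGroup F] [NormedSpace ℝ F] {s : Set E}
    (hs : MeasurableSet s) (f : E → F) (a : E) {R : ℝ} (hR : 0 < R) :
    ∫ x in (fun x ↦ a + R • x) ⁻¹' s, f (a + R • x) ∂μ =
      (R ^ Module.finrank ℝ E)⁻¹ • ∫ x in s, f x ∂μ := by
  have hm : Measurable fun x : E ↦ a + R • x := by fun_prop
  rw [← integral_indicator (hm hs), ← integral_indicator hs]
  have := Measure.integral_comp_smul_of_nonneg μ (fun x ↦ s.indicator f (a + x)) R (hR := hR.le)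
  rw [integral_add_left_eq_self (s.indicator f) a] at this
  rw [← this]
  rfl

/-- Poincaré-type inequality (Bombieri's Lemma 7): for `0 < θ ≤ 1` and
`1 ≤ p < n/(n−1)` there is `τ > 0` such that for any ball `B(x₀,R)`, any measurable
subset `A` of measure fraction at least `θ`, and any `C¹` function `h` with
`∫_A h = 0`, one has `(R⁻ⁿ ∫_B |h|ᵖ)^{1/p} ≤ τ R^{1−n} ∫_B ‖∇h‖`. -/
theorem poincare_type_inequality (n : ℕ) (hn : 1 ≤ n) (θ : ℝ) (hθ0 : 0 < θ)
    (hθ1 : θ ≤ 1) (p : ℝ) (hp1 : 1 ≤ p) (hpn : p * ((n : ℝ) - 1) < n) :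
    ∃ τ : ℝ, 0 < τ ∧
      ∀ (R : ℝ), 0 < R → ∀ (x₀ : EuclideanSpace ℝ (Fin n))
        (A : Set (EuclideanSpace ℝ (Fin n))), MeasurableSet A →
        A ⊆ Metric.ball x₀ R →
        θ * (volume (Metric.ball x₀ R)).toReal ≤ (volume A).toReal →
        ∀ h : EuclideanSpace ℝ (Fin n) → ℝ, ContDiff ℝ 1 h →
        (∫ x in A, h x) = 0 →
        (R ^ (-(n : ℝ)) * ∫ x in Metric.ball x₀ R, |h x| ^ p) ^ (1 / p) ≤
          τ * R ^ (1 - (n : ℝ)) * ∫ x in Metric.ball x₀ R, ‖fderiv ℝ h x‖ := by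
  have hfr : Module.finrank ℝ (EuclideanSpace ℝ (Fin n)) = n := finrank_euclideanSpace_fin
  have : Nontrivial (EuclideanSpace ℝ (Fin n)) :=
    Module.nontrivial_of_finrank_pos (R := ℝ) (by omega)
  obtain ⟨τ, hτ, H⟩ := exists_integral_unitBall_rpow_le
    (volume : Measure (EuclideanSpace ℝ (Fin n))) hθ0 hp1 (by rwa [hfr])
  refine ⟨τ, hτ, fun R hR x₀ A hA hAB hmA h hh hA0 ↦ ?_⟩
  have hball : (fun x ↦ x₀ + R • x) ⁻¹' Metric.ball x₀ R = Metric.ball 0 1 := by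
    ext x
    simp [norm_smul, abs_of_pos hR, hR]
  have hT : Measurable fun x : EuclideanSpace ℝ (Fin n) ↦ x₀ + R • x := by fun_prop
  have hvol : ∀ s : Set (EuclideanSpace ℝ (Fin n)), MeasurableSet s →
      volume.real ((fun x ↦ x₀ + R • x) ⁻¹' s) = (R ^ n)⁻¹ * volume.real s := by
    intro s hs
    have := setIntegral_preimage_add_smul volume hs (fun _ ↦ (1 : ℝ)) x₀ hR
    simpa [hfr] using this
  have h1 := H ((fun x ↦ x₀ + R • x) ⁻¹' A) (hT hA) (hball ▸ Set.preimage_mono hAB) (by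
      rw [← hball, hvol A hA, hvol _ measurableSet_ball, mul_left_comm]
      gcongr
      exact hmA)
    (fun x ↦ h (x₀ + R • x)) (hh.comp (by fun_prop)) (by
      rw [setIntegral_preimage_add_smul volume hA h x₀ hR, hA0, smul_zero])
  have hfd : ∀ x, ‖fderiv ℝ (fun x ↦ h (x₀ + R • x)) x‖ = R * ‖fderiv ℝ h (x₀ + R • x)‖ := by
    intro x
    rw [fderiv_comp_smul (f := fun y ↦ h (x₀ + y)), fderiv_comp_add_left, norm_smul,
      Real.norm_of_nonneg hR.le]
  simp_rw [hfd] at h1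
  rw [integral_const_mul, ← hball,
    setIntegral_preimage_add_smul volume measurableSet_ball (fun x ↦ |h x| ^ p) x₀ hR,
    setIntegral_preimage_add_smul volume measurableSet_ball (fun x ↦ ‖fderiv ℝ h x‖) x₀ hR,
    hfr, smul_eq_mul, smul_eq_mul] at h1
  rw [Real.rpow_neg hR.le, Real.rpow_sub hR, Real.rpow_one, Real.rpow_natCast]
  refine h1.trans_eq ?_
  ring
end

section
/- Let n, j ≥ 1 be integers, let R > 0 and K ≥ 0, and let φ : ℝⁿ → ℝʲ be Lebesgue-integrable on the ball B(0, R). Suppose that for every a ∈ B(0, R/2) and every r with 0 < r ≤ R/2 there exists a vector l_{r,a} ∈ ℝʲ such that ∫_{B(a,r)} ‖φ(x) − l_{r,a}‖ dx ≤ K · r^{n+1}. Then there exists a continuous function ψ : B(0, R/2) → ℝʲ with φ = ψ almost everywhere on B(0, R/2). -/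
open MeasureTheory

/-- A function that is uniformly continuous on a set `A` and takes values in a complete space
extends continuously to the closure of `A`. -/
theorem UniformContinuousOn.continuousOn_extendFrom_closure {X Y : Type*} [UniformSpace X]
    [UniformSpace Y] [CompleteSpace Y] {A : Set X} {f : X → Y}
    (hf : UniformContinuousOn f A) : ContinuousOn (extendFrom A f) (closure A) := by
  refine continuousOn_extendFrom subset_rfl fun x hx ↦ ?_
  have := mem_closure_iff_nhdsWithin_neBot.1 hx
  exact cauchy_map_iff_exists_tendsto.1
    ((cauchy_nhds.mono nhdsWithin_le_nhds).map_of_le hf inf_le_right)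

/-- The average of `f` over `s ⊆ t` is close to any vector that is close to `f` in `L¹(t)`. -/
theorem norm_setAverage_sub_le_setIntegral_div {α F : Type*} [MeasurableSpace α]
    [NormedAddCommGroup F] [NormedSpace ℝ F] [CompleteSpace F] {μ : Measure α} {f : α → F}
    {s t : Set α} (hst : s ⊆ t) (hf : IntegrableOn f t μ) (hs : μ s ≠ 0) (ht : μ t ≠ ⊤) (l : F) :
    ‖(⨍ x in s, f x ∂μ) - l‖ ≤ (∫ x in t, ‖f x - l‖ ∂μ) / μ.real s := by
  have hs' : μ s ≠ ⊤ := measure_ne_top_of_subset hst ht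
  have hpos : 0 < μ.real s := ENNReal.toReal_pos hs hs'
  have hint : IntegrableOn (fun x ↦ f x - l) t μ := hf.sub (integrableOn_const ht)
  have key : (⨍ x in s, f x ∂μ) - l = (μ.real s)⁻¹ • ∫ x in s, (f x - l) ∂μ := by
    rw [integral_sub (hf.mono_set hst) (integrableOn_const hs'), setIntegral_const, setAverage_eq,
      smul_sub, inv_smul_smul₀ hpos.ne']
  rw [key, norm_smul, norm_inv, Real.norm_of_nonneg hpos.le, div_eq_inv_mul]
  gcongr
  exact (norm_integral_le_integral_norm _).trans
    (setIntegral_mono_set hint.norm (Filter.Eventually.of_forall fun _ ↦ norm_nonneg _)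
      hst.eventuallyLE)

section Campanato

variable {E F : Type*} [NormedAddCommGroup E] [NormedSpace ℝ E] [FiniteDimensional ℝ E]
  [MeasurableSpace E] [BorelSpace E] {μ : Measure E} [μ.IsAddHaarMeasure]
  [NormedAddCommGroup F] [NormedSpace ℝ F] [CompleteSpace F]

theorem ae_tendsto_average_ball_div_two_pow {f : E → F} (hf : LocallyIntegrable f μ) :
    ∀ᵐ x ∂μ, ∀ r : ℝ, 0 < r →
      Filter.Tendsto (fun k : ℕ ↦ ⨍ y in Metric.ball x (r / 2 ^ k), f y ∂μ) Filter.atTop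
        (nhds (f x)) := by
  filter_upwards [IsUnifLocDoublingMeasure.ae_tendsto_average μ hf 1] with x hx r hr
  have hpos (k : ℕ) : 0 < r / 2 ^ k := by positivity
  have hlim : Filter.Tendsto (fun k : ℕ ↦ r / 2 ^ k) Filter.atTop (nhdsWithin 0 (Set.Ioi 0)) := by
    refine tendsto_nhdsWithin_iff.2 ⟨?_, Filter.Eventually.of_forall hpos⟩
    simpa [div_eq_mul_inv] using
      (tendsto_pow_atTop_nhds_zero_of_lt_one (r := (2 : ℝ)⁻¹) (by norm_num)
        (by norm_num)).const_mul r
  refine (hx (fun _ ↦ x) _ hlim (Filter.Eventually.of_forall fun k ↦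
    Metric.mem_closedBall_self (by simpa using (hpos k).le))).congr fun k ↦ ?_
  refine setAverage_congr ?_
  rw [← Metric.ball_union_sphere]
  exact union_ae_eq_left_of_ae_eq_empty
    (ae_eq_empty.2 (Measure.addHaar_sphere_of_ne_zero μ x (hpos k).ne'))

/-- On a ball `B(y,s) ⊆ B(x,r)` of comparable radius, the average of `f` is close to a vector
approximating `f` on `B(x,r)`. -/
theorem norm_average_ball_sub_le {f : E → F} {K r s : ℝ} {x y : E} {l : F}
    (hs : 0 < s) (hrs : r ≤ 2 * s) (hsub : Metric.ball y s ⊆ Metric.ball x r) (hr : 0 < r)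
    (hf : IntegrableOn f (Metric.ball x r) μ)
    (hl : ∫ z in Metric.ball x r, ‖f z - l‖ ∂μ ≤ K * r ^ (Module.finrank ℝ E + 1)) :
    ‖(⨍ z in Metric.ball y s, f z ∂μ) - l‖ ≤
      2 ^ Module.finrank ℝ E * K / μ.real (Metric.ball 0 1) * r := by
  have hK : 0 ≤ K := nonneg_of_mul_nonneg_left
    ((integral_nonneg fun _ ↦ norm_nonneg _).trans hl) (by positivity)
  have hv : 0 < μ.real (Metric.ball (0 : E) 1) :=
    ENNReal.toReal_pos (Metric.measure_ball_pos μ _ one_pos).ne' measure_ball_lt_top.ne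
  have hball : μ.real (Metric.ball y s) =
      s ^ Module.finrank ℝ E * μ.real (Metric.ball (0 : E) 1) := by
    rw [measureReal_def, Measure.addHaar_ball_of_pos μ y hs, ENNReal.toReal_mul,
      ENNReal.toReal_ofReal (by positivity), measureReal_def]
  refine (norm_setAverage_sub_le_setIntegral_div hsub hf (Metric.measure_ball_pos μ _ hs).ne'
    measure_ball_lt_top.ne l).trans ?_
  rw [hball, div_le_iff₀ (by positivity)]
  calc ∫ z in Metric.ball x r, ‖f z - l‖ ∂μ
      ≤ K * r * r ^ Module.finrank ℝ E := hl.trans_eq (by ring)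
    _ ≤ K * r * (2 * s) ^ Module.finrank ℝ E := by gcongr
    _ = _ := by rw [mul_pow]; field_simp

/-- If `f` is approximated on the balls centred at `x` by constants, with error
`O(r ^ (d + 1))` in `L¹`, then its averages converge to their limit at rate `O(r)`. -/
theorem dist_average_ball_le_of_tendsto {f : E → F} {K r : ℝ} {x : E} {z : F} (hr : 0 < r)
    (hf : IntegrableOn f (Metric.ball x r) μ)
    (happrox : ∀ s : ℝ, 0 < s → s ≤ r → ∃ l : F,
      ∫ y in Metric.ball x s, ‖f y - l‖ ∂μ ≤ K * s ^ (Module.finrank ℝ E + 1))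
    (hz : Filter.Tendsto (fun k : ℕ ↦ ⨍ y in Metric.ball x (r / 2 ^ k), f y ∂μ) Filter.atTop
      (nhds z)) :
    dist (⨍ y in Metric.ball x r, f y ∂μ) z ≤
      4 * (2 ^ Module.finrank ℝ E * K / μ.real (Metric.ball (0 : E) 1)) * r := by
  set M := 2 ^ Module.finrank ℝ E * K / μ.real (Metric.ball (0 : E) 1)
  have hstep (k : ℕ) : dist (⨍ y in Metric.ball x (r / 2 ^ k), f y ∂μ)
      (⨍ y in Metric.ball x (r / 2 ^ (k + 1)), f y ∂μ) ≤ 4 * M * r / 2 / 2 ^ k := by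
    have hpos : 0 < r / 2 ^ k := by positivity
    have hle : r / 2 ^ k ≤ r := div_le_self hr.le (one_le_pow₀ one_le_two)
    obtain ⟨l, hl⟩ := happrox _ hpos hle
    have hfk := hf.mono_set (Metric.ball_subset_ball (x := x) hle)
    have hhalf : r / 2 ^ (k + 1) = r / 2 ^ k / 2 := by rw [pow_succ, div_div]
    have h₁ := norm_average_ball_sub_le hpos (by linarith) subset_rfl hpos hfk hl
    have h₂ := norm_average_ball_sub_le (s := r / 2 ^ (k + 1)) (y := x) (by positivity)
      (by linarith) (Metric.ball_subset_ball (by linarith)) hpos hfk hl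
    rw [← dist_eq_norm] at h₁ h₂
    calc _ ≤ M * (r / 2 ^ k) + M * (r / 2 ^ k) :=
          (dist_triangle_right _ _ l).trans (add_le_add h₁ h₂)
      _ = _ := by ring
  simpa using dist_le_of_le_geometric_two_of_tendsto₀ hstep hz

end Campanato


/-- Campanato-type criterion: if an integrable `φ` is approximated on every ball
`B(a,r)` (`a ∈ B(0,R/2)`, `r ≤ R/2`) by a constant `l_{r,a}` with error
`∫_{B(a,r)} ‖φ − l_{r,a}‖ ≤ K r^{n+1}`, then `φ` has a continuous representative
on `B(0,R/2)`. -/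
theorem campanato_continuous_representative (n j : ℕ) (hn : 1 ≤ n) (hj : 1 ≤ j)
    (R K : ℝ) (hR : 0 < R) (hK : 0 ≤ K)
    (φ : EuclideanSpace ℝ (Fin n) → EuclideanSpace ℝ (Fin j))
    (hφ : IntegrableOn φ (Metric.ball (0 : EuclideanSpace ℝ (Fin n)) R))
    (happrox : ∀ a ∈ Metric.ball (0 : EuclideanSpace ℝ (Fin n)) (R / 2),
      ∀ r : ℝ, 0 < r → r ≤ R / 2 →
        ∃ l : EuclideanSpace ℝ (Fin j),
          (∫ x in Metric.ball a r, ‖φ x - l‖) ≤ K * r ^ (n + 1)) :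
    ∃ ψ : EuclideanSpace ℝ (Fin n) → EuclideanSpace ℝ (Fin j),
      ContinuousOn ψ (Metric.ball (0 : EuclideanSpace ℝ (Fin n)) (R / 2)) ∧
      ∀ᵐ x ∂(volume.restrict (Metric.ball (0 : EuclideanSpace ℝ (Fin n)) (R / 2))),
        φ x = ψ x := by
  set d := Module.finrank ℝ (EuclideanSpace ℝ (Fin n))
  have hdn : n + 1 = d + 1 := congrArg (· + 1) finrank_euclideanSpace_fin.symm
  rw [hdn] at happrox
  set B := Metric.ball (0 : EuclideanSpace ℝ (Fin n)) (R / 2)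
  set M := 2 ^ d * K / volume.real (Metric.ball (0 : EuclideanSpace ℝ (Fin n)) 1)
  have hM : 0 ≤ M := by positivity
  have hsub {a : EuclideanSpace ℝ (Fin n)} (ha : a ∈ B) {r : ℝ} (hr : r ≤ R / 2) :
      Metric.ball a r ⊆ Metric.ball 0 R :=
    Metric.ball_subset_ball' (by linarith [Metric.mem_ball.1 ha])
  have hint {a : EuclideanSpace ℝ (Fin n)} (ha : a ∈ B) {r : ℝ} (hr : r ≤ R / 2) :
      IntegrableOn φ (Metric.ball a r) := hφ.mono_set (hsub ha hr)
  let G : Set (EuclideanSpace ℝ (Fin n)) := {x | ∀ r : ℝ, 0 < r → r ≤ R / 2 →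
    Filter.Tendsto (fun k : ℕ ↦ ⨍ y in Metric.ball x (r / 2 ^ k), φ y) Filter.atTop (nhds (φ x))}
  have hG : ∀ᵐ x, x ∈ B → x ∈ G := by
    filter_upwards [ae_tendsto_average_ball_div_two_pow
      (hφ.integrable_indicator measurableSet_ball).locallyIntegrable] with x hx hxB r hr hrR
    have h := hx r hr
    rw [Set.indicator_of_mem (Metric.ball_subset_ball (by linarith) hxB)] at h
    refine h.congr fun k ↦ setAverage_congr_fun measurableSet_ball (.of_forall fun y hy ↦ ?_)
    exact Set.indicator_of_mem
      (hsub hxB ((div_le_self hr.le (one_le_pow₀ one_le_two)).trans hrR) hy) _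
  have havg {x} (hx : x ∈ B ∩ G) {r : ℝ} (hr : 0 < r) (hrR : r ≤ R / 2) :
      dist (⨍ y in Metric.ball x r, φ y) (φ x) ≤ 4 * M * r :=
    dist_average_ball_le_of_tendsto hr (hint hx.1 hrR)
      (fun s hs hsr ↦ happrox x hx.1 s hs (hsr.trans hrR)) (hx.2 r hr hrR)
  have hlip : ∀ x ∈ B ∩ G, ∀ y ∈ B ∩ G, dist x y ≤ R / 4 →
      dist (φ x) (φ y) ≤ 16 * M * dist x y := by
    intro x hx y hy hxy
    rcases eq_or_ne x y with rfl | hne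
    · simp
    have hpos : 0 < dist x y := dist_pos.2 hne
    obtain ⟨l, hl⟩ := happrox x hx.1 (2 * dist x y) (by linarith) (by linarith)
    have hx2 := hint hx.1 (r := 2 * dist x y) (by linarith)
    have h₁ := norm_average_ball_sub_le (by linarith) (by linarith) subset_rfl (by linarith) hx2 hl
    have h₂ := norm_average_ball_sub_le hpos le_rfl
      (Metric.ball_subset_ball' (x := y) (by rw [dist_comm y x]; linarith)) (by linarith) hx2 hl
    rw [← dist_eq_norm] at h₁ h₂
    have h₃ := havg hx (r := 2 * dist x y) (by linarith) (by linarith)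
    have h₄ := havg hy hpos (by linarith)
    have h₅ := dist_triangle4 (φ x) (⨍ z in Metric.ball x (2 * dist x y), φ z)
      (⨍ z in Metric.ball y (dist x y), φ z) (φ y)
    have h₆ := dist_triangle_right (⨍ z in Metric.ball x (2 * dist x y), φ z)
      (⨍ z in Metric.ball y (dist x y), φ z) l
    change _ ≤ M * _ at h₁ h₂
    rw [dist_comm] at h₃
    linarith
  have huc : UniformContinuousOn φ (B ∩ G) := by
    refine Metric.uniformContinuousOn_iff_le.2 fun ε hε ↦
      ⟨min (R / 4) (ε / (16 * M + 1)), by positivity, fun x hx y hy hxy ↦ ?_⟩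
    have h := (le_div_iff₀ (by positivity)).1 (hxy.trans (min_le_right _ _))
    linarith [hlip x hx y hy (hxy.trans (min_le_left _ _)), dist_nonneg (x := x) (y := y)]
  have hcl : B ⊆ closure (B ∩ G) := by
    refine (Measure.dense_of_ae hG).open_subset_closure_inter Metric.isOpen_ball |>.trans
      (closure_mono fun x hx ↦ ⟨hx.1, hx.2 hx.1⟩)
  refine ⟨extendFrom (B ∩ G) φ, huc.continuousOn_extendFrom_closure.mono hcl, ?_⟩
  filter_upwards [ae_restrict_mem measurableSet_ball, ae_restrict_of_ae hG] with x hxB hxG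
  exact (extendFrom_extends huc.continuousOn x ⟨hxB, hxG hxB⟩).symm
end

section
/- Let n, j ≥ 1 be integers, let R > 0 and K ≥ 0, and let f : ℝⁿ → ℝʲ be a Lipschitz function. Suppose that for every a ∈ B(0, R/2) and every r with 0 < r ≤ R/2 there exists a linear map l_{r,a} : ℝⁿ → ℝʲ such that ∫_{B(a,r)} ‖Df(x) − l_{r,a}‖ dx ≤ K · r^{n+1}, where Df(x) denotes the Fréchet derivative of f (which exists for almost every x by Rademacher's theorem) and the norm is the operator norm. Then f is continuously differentiable on B(0, R/2): there is a continuous map D : B(0, R/2) → L(ℝⁿ, ℝʲ) such that f is differentiable at every a ∈ B(0, R/2) with derivative D(a). -/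
open MeasureTheory

open Filter Metric Module
open scoped Topology NNReal

/-- The average of `g` over `s` deviates from `l` by at most the integral of `‖g - l‖` over any
larger set, divided by the measure of `s`. -/
theorem norm_setAverage_sub_le_of_subset {α G : Type*} [MeasurableSpace α] {μ : Measure α}
    [NormedAddCommGroup G] [NormedSpace ℝ G] [CompleteSpace G] {g : α → G} {s t : Set α} (l : G)
    (hst : s ⊆ t) (hs₀ : μ s ≠ 0) (ht : μ t ≠ ⊤) (hg : IntegrableOn g t μ) :
    ‖(⨍ x in s, g x ∂μ) - l‖ ≤ (μ.real s)⁻¹ * ∫ x in t, ‖g x - l‖ ∂μ := by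
  have hs : μ s ≠ ⊤ := measure_ne_top_of_subset hst ht
  have hgl : IntegrableOn (fun x ↦ g x - l) t μ := hg.sub (integrableOn_const ht)
  have hmean : (⨍ x in s, g x ∂μ) - l = (μ.real s)⁻¹ • ∫ x in s, (g x - l) ∂μ := by
    rw [integral_sub (hg.mono_set hst) (integrableOn_const hs), smul_sub, ← setAverage_eq,
      ← setAverage_eq, setAverage_const hs₀ hs]
  rw [hmean, norm_smul, norm_inv, Real.norm_of_nonneg measureReal_nonneg]
  gcongr
  exact (norm_integral_le_integral_norm _).trans
    (setIntegral_mono_set hgl.norm (Eventually.of_forall fun _ ↦ norm_nonneg _)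
      hst.eventuallyLE)

theorem setAverage_ball_add_left {E G : Type*} [NormedAddCommGroup E] [MeasurableSpace E]
    [BorelSpace E] {μ : Measure E} [μ.IsAddHaarMeasure] [NormedAddCommGroup G] [NormedSpace ℝ G]
    (g : E → G) (x : E) (r : ℝ) :
    ⨍ z in ball 0 r, g (x + z) ∂μ = ⨍ z in ball x r, g z ∂μ := by
  rw [setAverage_eq, setAverage_eq, Measure.addHaar_real_ball_center μ x,
    ← (measurePreserving_add_left μ x).setIntegral_preimage_emb
      (measurableEmbedding_addLeft x) g (ball x r)]
  simp

section Haar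

variable {E : Type*} [NormedAddCommGroup E] [NormedSpace ℝ E] [FiniteDimensional ℝ E]
  [MeasurableSpace E] [BorelSpace E] {μ : Measure E} [μ.IsAddHaarMeasure]

theorem measureReal_ball_eq_pow_mul (μ : Measure E) [μ.IsAddHaarMeasure] (x : E) {r : ℝ}
    (hr : 0 < r) : μ.real (ball x r) = r ^ finrank ℝ E * μ.real (ball 0 1) := by
  rw [measureReal_def, Measure.addHaar_ball_of_pos μ x hr, ENNReal.toReal_mul,
    ENNReal.toReal_ofReal (by positivity), measureReal_def]

/-- Under a Campanato condition with exponent one, averages over two balls of radius comparable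
to `s` and centers at distance at most `s` from `a` differ by at most a multiple of `s`. -/
theorem exists_dist_setAverage_ball_le {G : Type*} [NormedAddCommGroup G] [NormedSpace ℝ G]
    [CompleteSpace G] {g : E → G} (hg : LocallyIntegrable g μ) {S : Set E} {K r₀ : ℝ}
    (hK : 0 ≤ K)
    (h : ∀ a ∈ S, ∀ r, 0 < r → r ≤ r₀ →
      ∃ l : G, (∫ x in ball a r, ‖g x - l‖ ∂μ) ≤ K * r ^ (finrank ℝ E + 1)) :
    ∃ C, 0 ≤ C ∧ ∀ a ∈ S, ∀ s, 0 < s → 2 * s ≤ r₀ → ∀ x ∈ closedBall a s, ∀ y ∈ closedBall a s,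
      ∀ p ∈ Set.Icc (s / 2) s, ∀ q ∈ Set.Icc (s / 2) s,
        dist (⨍ z in ball x p, g z ∂μ) (⨍ z in ball y q, g z ∂μ) ≤ C * s := by
  set n := finrank ℝ E
  set ω := μ.real (ball (0 : E) 1)
  have hω : 0 < ω :=
    ENNReal.toReal_pos (measure_ball_pos μ 0 one_pos).ne' measure_ball_lt_top.ne
  refine ⟨2 * (2 * 4 ^ n * K / ω), by positivity, fun a ha s hs hsr x hx y hy p hp q hq ↦ ?_⟩
  obtain ⟨l, hl⟩ := h a ha (2 * s) (by positivity) hsr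
  have key : ∀ x ∈ closedBall a s, ∀ p ∈ Set.Icc (s / 2) s,
      dist (⨍ z in ball x p, g z ∂μ) l ≤ 2 * 4 ^ n * K / ω * s := by
    intro x hx p hp
    have hp₀ : 0 < p := by linarith [hp.1]
    have hsub : ball x p ⊆ ball a (2 * s) :=
      ball_subset_ball' (by linarith [hp.2, mem_closedBall.1 hx])
    rw [dist_eq_norm]
    calc ‖(⨍ z in ball x p, g z ∂μ) - l‖
        ≤ (μ.real (ball x p))⁻¹ * ∫ z in ball a (2 * s), ‖g z - l‖ ∂μ :=
          norm_setAverage_sub_le_of_subset l hsub (measure_ball_pos μ x hp₀).ne'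
            measure_ball_lt_top.ne
            ((hg.integrableOn_isCompact (isCompact_closedBall a (2 * s))).mono_set
              ball_subset_closedBall)
      _ ≤ ((s / 2) ^ n * ω)⁻¹ * (K * (2 * s) ^ (n + 1)) := by
          rw [measureReal_ball_eq_pow_mul μ x hp₀]
          gcongr
          exact hp.1
      _ = 2 * 4 ^ n * K / ω * s := by
          rw [show (4 : ℝ) = 2 * 2 by norm_num, mul_pow, div_pow, mul_pow]
          field_simp
          ring
  calc _ ≤ _ := dist_triangle_right _ _ l
    _ ≤ _ := add_le_add (key x hx p hp) (key y hy q hq)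
    _ = _ := by ring

variable {F : Type*} [NormedAddCommGroup F] [NormedSpace ℝ F] [FiniteDimensional ℝ F]
  {f : E → F} {c : ℝ≥0}

theorem LipschitzWith.locallyIntegrable_fderiv (hf : LipschitzWith c f) :
    LocallyIntegrable (fderiv ℝ f) μ := by
  borelize (E →L[ℝ] F)
  refine (locallyIntegrable_const (c : ℝ)).mono
    (measurable_fderiv ℝ f).aestronglyMeasurable (Eventually.of_forall fun x ↦ ?_)
  simpa using norm_fderiv_le_of_lipschitz ℝ hf

/-- The averages of a Lipschitz map over balls of fixed radius are differentiable in the center,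
and the derivative is the average of the derivative. -/
theorem LipschitzWith.hasFDerivAt_setAverage_ball (hf : LipschitzWith c f) (x : E) (r : ℝ) :
    HasFDerivAt (fun y ↦ ⨍ z in ball y r, f z ∂μ) (⨍ z in ball x r, fderiv ℝ f z ∂μ) x := by
  borelize (E →L[ℝ] F)
  simp_rw [← setAverage_ball_add_left f, ← setAverage_ball_add_left (fderiv ℝ f), setAverage_eq]
  have : IsFiniteMeasure (μ.restrict (ball (0 : E) r)) :=
    isFiniteMeasure_restrict.2 measure_ball_lt_top.ne
  have hcont (y : E) : Continuous fun z ↦ f (y + z) := by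
    have := hf.continuous
    fun_prop
  have hdiff : ∀ᵐ z ∂μ, DifferentiableAt ℝ f (x + z) :=
    (measurePreserving_add_left μ x).quasiMeasurePreserving.ae hf.ae_differentiableAt
  refine (hasFDerivAt_integral_of_dominated_loc_of_lip (bound := fun _ ↦ (c : ℝ)) univ_mem
    (Eventually.of_forall fun y ↦ (hcont y).aestronglyMeasurable) ?_ ?_ ?_
    (integrable_const _) ?_).2.const_smul _
  · exact ((hcont x).locallyIntegrable.integrableOn_isCompact
      (isCompact_closedBall 0 r)).mono_set ball_subset_closedBall
  · exact ((measurable_fderiv ℝ f).comp (measurable_const_add x)).aestronglyMeasurable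
  · refine Eventually.of_forall fun z ↦ LipschitzWith.lipschitzOnWith ?_
    refine LipschitzWith.of_dist_le_mul fun y y' ↦ ?_
    simpa using hf.dist_le_mul (y + z) (y' + z)
  · refine ae_restrict_of_ae (hdiff.mono fun z hz ↦ ?_)
    exact (hasFDerivAt_comp_add_right z).2 hz.hasFDerivAt

theorem LipschitzWith.dist_setAverage_ball_le (hf : LipschitzWith c f) (x : E) {r : ℝ}
    (hr : 0 < r) : dist (⨍ z in ball x r, f z ∂μ) (f x) ≤ c * r := by
  rw [← mem_closedBall]
  refine (convex_closedBall (f x) (c * r)).set_average_mem isClosed_closedBall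
    (measure_ball_pos μ x hr).ne' measure_ball_lt_top.ne ?_ ?_
  · refine (ae_restrict_mem measurableSet_ball).mono fun z hz ↦ ?_
    exact (hf.dist_le_mul z x).trans (by gcongr; exact (mem_ball.1 hz).le)
  · exact (hf.continuous.locallyIntegrable.integrableOn_isCompact
      (isCompact_closedBall x r)).mono_set ball_subset_closedBall

end Haar

/-- A sequence of functions with geometrically decaying increments converges uniformly, and the
limit is continuous as soon as the `k`-th function oscillates at scale `ρ / 2 ^ k` by at most a
multiple of `2⁻ᵏ`. -/
theorem exists_tendstoUniformlyOn_continuousOn_of_dist_le {X G : Type*} [PseudoMetricSpace X]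
    [MetricSpace G] [CompleteSpace G] {A : ℕ → X → G} {S : Set X} {C ρ : ℝ} (hρ : 0 < ρ)
    (hstep : ∀ k, ∀ x ∈ S, dist (A k x) (A (k + 1) x) ≤ C / 2 / 2 ^ k)
    (hosc : ∀ k, ∀ x ∈ S, ∀ y ∈ S, dist y x ≤ ρ / 2 ^ k → dist (A k y) (A k x) ≤ C / 2 ^ k) :
    ∃ D : X → G, TendstoUniformlyOn A D atTop S ∧ ContinuousOn D S := by
  have hlim : ∀ x, ∃ d, x ∈ S → Tendsto (A · x) atTop (𝓝 d) := by
    intro x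
    by_cases hx : x ∈ S
    · obtain ⟨d, hd⟩ := cauchySeq_tendsto_of_complete
        (cauchySeq_of_le_geometric_two fun k ↦ hstep k x hx)
      exact ⟨d, fun _ ↦ hd⟩
    · exact ⟨A 0 x, fun h ↦ absurd h hx⟩
  choose D hD using hlim
  have hAD : ∀ k, ∀ x ∈ S, dist (A k x) (D x) ≤ C / 2 ^ k := fun k x hx ↦
    dist_le_of_le_geometric_two_of_tendsto (fun k ↦ hstep k x hx) (hD x hx) k
  have hsmall (M : ℝ) : Tendsto (fun k : ℕ ↦ M / 2 ^ k) atTop (𝓝 0) :=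
    tendsto_const_nhds.div_atTop (tendsto_pow_atTop_atTop_of_one_lt one_lt_two)
  refine ⟨D, Metric.tendstoUniformlyOn_iff.2 fun ε hε ↦ ?_, Metric.continuousOn_iff.2 ?_⟩
  · filter_upwards [(hsmall C).eventually_lt_const hε] with k hk x hx
    rw [dist_comm]
    exact (hAD k x hx).trans_lt hk
  · intro x hx ε hε
    obtain ⟨k, hk⟩ := ((hsmall (3 * C)).eventually_lt_const hε).exists
    refine ⟨ρ / 2 ^ k, by positivity, fun y hy hyx ↦ ?_⟩
    calc dist (D y) (D x)
        ≤ dist (D y) (A k y) + dist (A k y) (A k x) + dist (A k x) (D x) :=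
          dist_triangle4 _ _ _ _
      _ ≤ C / 2 ^ k + C / 2 ^ k + C / 2 ^ k := by
          rw [dist_comm (D y)]
          gcongr
          exacts [hAD k y hy, hosc k x hx y hy hyx.le, hAD k x hx]
      _ = 3 * C / 2 ^ k := by ring
      _ < ε := hk

/-- Proposition 18: if a Lipschitz map `f` satisfies the Campanato-type decay
`∫_{B(a,r)} ‖Df − l_{r,a}‖ ≤ K r^{n+1}` for linear maps `l_{r,a}`, for all centers
`a ∈ B(0,R/2)` and radii `r ≤ R/2`, then `f` is `C¹` on `B(0,R/2)`. -/
theorem lipschitz_campanato_C1 (n j : ℕ) (hn : 1 ≤ n) (hj : 1 ≤ j)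
    (R K : ℝ) (hR : 0 < R) (hK : 0 ≤ K)
    (f : EuclideanSpace ℝ (Fin n) → EuclideanSpace ℝ (Fin j))
    (c : NNReal) (hf : LipschitzWith c f)
    (happrox : ∀ a ∈ Metric.ball (0 : EuclideanSpace ℝ (Fin n)) (R / 2),
      ∀ r : ℝ, 0 < r → r ≤ R / 2 →
        ∃ l : EuclideanSpace ℝ (Fin n) →L[ℝ] EuclideanSpace ℝ (Fin j),
          (∫ x in Metric.ball a r, ‖fderiv ℝ f x - l‖) ≤ K * r ^ (n + 1)) :
    ∃ D : EuclideanSpace ℝ (Fin n) →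
        (EuclideanSpace ℝ (Fin n) →L[ℝ] EuclideanSpace ℝ (Fin j)),
      ContinuousOn D (Metric.ball (0 : EuclideanSpace ℝ (Fin n)) (R / 2)) ∧
      ∀ a ∈ Metric.ball (0 : EuclideanSpace ℝ (Fin n)) (R / 2),
        HasFDerivAt f (D a) a := by
  set S := ball (0 : EuclideanSpace ℝ (Fin n)) (R / 2)
  obtain ⟨C, hC, hosc⟩ := exists_dist_setAverage_ball_le (S := S) (r₀ := R / 2) (K := K)
    (hf.locallyIntegrable_fderiv (μ := volume)) hK (by simpa using happrox)
  set s : ℕ → ℝ := fun k ↦ R / 4 / 2 ^ k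
  have hs (k : ℕ) : 0 < s k := by positivity
  have hsR (k : ℕ) : 2 * s k ≤ R / 2 := by
    have : s k ≤ R / 4 := div_le_self (by positivity) (one_le_pow₀ one_le_two)
    linarith
  have hs_succ (k : ℕ) : s (k + 1) = s k / 2 := by
    simp only [s, pow_succ]
    field_simp
  have hs_lim : Tendsto s atTop (𝓝 0) :=
    tendsto_const_nhds.div_atTop (tendsto_pow_atTop_atTop_of_one_lt one_lt_two)
  have hself (k : ℕ) (x : EuclideanSpace ℝ (Fin n)) : x ∈ closedBall x (s k) :=
    mem_closedBall_self (hs k).le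
  have hscale (k : ℕ) : s k ∈ Set.Icc (s k / 2) (s k) := ⟨by linarith [hs k], le_rfl⟩
  obtain ⟨D, hD, hDcont⟩ := exists_tendstoUniformlyOn_continuousOn_of_dist_le (S := S)
    (A := fun k x ↦ ⨍ z in ball x (s k), fderiv ℝ f z) (C := 2 * (C * (R / 4)))
    (ρ := R / 4) (by positivity)
    (fun k x hx ↦ by
      refine (hosc x hx (s k) (hs k) (hsR k) x (hself k x) x (hself k x) (s k) (hscale k)
        (s (k + 1)) ⟨(hs_succ k).ge, by linarith [hs_succ k, hs k]⟩).trans_eq ?_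
      simp only [s]
      ring)
    (fun k x hx y hy hyx ↦ by
      refine (hosc x hx (s k) (hs k) (hsR k) y hyx x (hself k x) (s k) (hscale k) (s k)
        (hscale k)).trans ?_
      have : 0 ≤ C * s k := mul_nonneg hC (hs k).le
      calc C * s k ≤ 2 * (C * s k) := by linarith
        _ = 2 * (C * (R / 4)) / 2 ^ k := by simp only [s]; ring)
  refine ⟨D, hDcont, fun a ha ↦ hasFDerivAt_of_tendstoUniformlyOn isOpen_ball hD
    (fun k x _ ↦ hf.hasFDerivAt_setAverage_ball x (s k)) (fun x _ ↦ ?_) ha⟩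
  refine tendsto_iff_dist_tendsto_zero.2 (squeeze_zero (fun _ ↦ dist_nonneg)
    (fun k ↦ hf.dist_setAverage_ball_le x (hs k)) ?_)
  simpa using hs_lim.const_mul (c : ℝ)
end
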